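/- arXiv:2404.14994 — 3 statements merged into one kernel-verified Lean document; each statement's English description precedes it below -/
import Mathlib

section
/- Fix integers t ≥ 2 and h with 0 ≤ h ≤ t − 2, and for j ∈ {1, …, t − 1} let g(j) = √(1/(t−1))·√(1/(j+h)) + √(1 − 1/(t−1))·√(1 − 1/(j+h)). Then hardmax((g(1), …, g(t−1)))_j = 1 if j = t − 1 − h and 0 otherwise; that is, the hardmax of the score vector is the standard basis vector at coordinate t − 1 − h. -/
open scoped Classical in
/-- `hardmax x` assigns `1/|argmax(x)|` to each coordinate in the argmax set of `x`
and `0` to all other coordinates. -/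
noncomputable def hardmax {D : ℕ} (x : Fin D → ℝ) : Fin D → ℝ :=
  fun d => if ∀ i, x i ≤ x d
    then 1 / ((Finset.univ.filter fun i => ∀ j, x j ≤ x i).card : ℝ)
    else 0

theorem hardmax_of_forall_lt {D : ℕ} {x : Fin D → ℝ} {k : Fin D}
    (hk : ∀ i, i ≠ k → x i < x k) (d : Fin D) :
    hardmax x d = if d = k then 1 else 0 := by
  have hmax : ∀ i, (∀ j, x j ≤ x i) ↔ i = k := by
    intro i
    constructor
    · intro hi
      by_contra hne
      exact (hk i hne).not_ge (hi k)
    · rintro rfl j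
      by_cases hj : j = i
      · rw [hj]
      · exact (hk j hj).le
  have hcard [DecidablePred fun i : Fin D => i = k] :
      (Finset.univ.filter fun i => i = k).card = 1 :=
    Finset.card_eq_one.2 ⟨k, by ext; simp⟩
  simp [hardmax, hmax, hcard]

theorem sqrt_mul_sqrt_add_self {a : ℝ} (ha0 : 0 ≤ a) (ha1 : a ≤ 1) :
    √a * √a + √(1 - a) * √(1 - a) = 1 := by
  rw [Real.mul_self_sqrt ha0, Real.mul_self_sqrt (sub_nonneg.2 ha1)]
  ring

theorem sqrt_mul_sqrt_add_lt_one {a b : ℝ} (ha0 : 0 ≤ a) (ha1 : a ≤ 1)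
    (hb0 : 0 ≤ b) (hb1 : b ≤ 1) (hab : a ≠ b) :
    √a * √b + √(1 - a) * √(1 - b) < 1 := by
  have hne : √a - √b ≠ 0 := by
    rwa [sub_ne_zero, Ne, Real.sqrt_inj ha0 hb0]
  have hpos : 0 < (√a - √b) ^ 2 := by positivity
  linarith [sq_nonneg (√(1 - a) - √(1 - b)), sqrt_mul_sqrt_add_self ha0 ha1,
    sqrt_mul_sqrt_add_self hb0 hb1]

/-- For integers `t ≥ 2` and `0 ≤ h ≤ t − 2`, with
`g(j) = √(1/(t−1))·√(1/(j+h)) + √(1 − 1/(t−1))·√(1 − 1/(j+h))`, the hardmax of the score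
vector `(g(1), …, g(t−1))` is the standard basis vector at coordinate `t − 1 − h`. -/
theorem hardmax_sqrt_scores (t h : ℕ) (ht : 2 ≤ t) (hh : h ≤ t - 2)
    (g : ℕ → ℝ)
    (hg : ∀ j, g j =
      Real.sqrt (1 / ((t : ℝ) - 1)) * Real.sqrt (1 / ((j : ℝ) + (h : ℝ)))
      + Real.sqrt (1 - 1 / ((t : ℝ) - 1)) * Real.sqrt (1 - 1 / ((j : ℝ) + (h : ℝ)))) :
    ∀ d : Fin (t - 1),
      hardmax (fun i : Fin (t - 1) => g ((i : ℕ) + 1)) d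
        = if (d : ℕ) + 1 = t - 1 - h then 1 else 0 := by
  intro d
  have hk : t - 1 - h - 1 < t - 1 := by omega
  have ha1 : 1 ≤ (t : ℝ) - 1 := by
    have : (2 : ℝ) ≤ t := by exact_mod_cast ht
    linarith
  have hmax : g (t - 1 - h - 1 + 1) = 1 := by
    have hcast : ((t - 1 - h - 1 + 1 : ℕ) : ℝ) + h = t - 1 := by
      rw [eq_sub_iff_add_eq]
      norm_cast
      omega
    rw [hg, hcast]
    exact sqrt_mul_sqrt_add_self (by positivity) ((div_le_one (by positivity)).2 ha1)
  rw [hardmax_of_forall_lt (k := ⟨t - 1 - h - 1, hk⟩)]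
  · congr 1
    rw [Fin.ext_iff, eq_iff_iff]
    dsimp only
    omega
  · intro i hi
    have hb1 : 1 ≤ ((i + 1 : ℕ) : ℝ) + h := by
      norm_cast
      omega
    simp only [hmax]
    rw [hg]
    refine sqrt_mul_sqrt_add_lt_one (by positivity) ((div_le_one (by positivity)).2 ha1)
      (by positivity) ((div_le_one (by positivity)).2 hb1) fun hab => hi ?_
    rw [one_div, one_div, inv_inj, sub_eq_iff_eq_add] at hab
    norm_cast at hab
    rw [Fin.ext_iff]
    dsimp only
    omega
end

section
/- Let N ≥ 1 be an integer, let d_1, …, d_N ∈ {0,1}, set x = Σ_{j=1}^N d_j · 10^{−j}, and define φ : ℝ → ℝ by φ(z) = 10^{N+1} · (ReLU(z) − ReLU(z − 10^{−(N+1)})). Define r_1, …, r_N recursively by r_i = φ(10^i · x − Σ_{j=1}^{i−1} 10^{i−j} · r_j − 1 + 10^{−(N+1)}). Then r_i = d_i for all i ∈ {1, …, N}. -/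
/-- The digits of a `0`-`1` decimal expansion strictly between positions `i` and `n + 1`,
shifted by `10 ^ i`, contribute at most `(1 - 10 ^ (i - n)) / 9`. -/
lemma sum_Ioc_digits_le {d : ℕ → ℝ} (hd : ∀ j, d j ≤ 1) {i n : ℕ} (hin : i ≤ n) :
    ∑ j ∈ Finset.Ioc i n, (10 : ℝ) ^ ((i : ℤ) - (j : ℤ)) * d j
      ≤ (1 - (10 : ℝ) ^ ((i : ℤ) - (n : ℤ))) / 9 := by
  induction n, hin using Nat.le_induction with
  | base => simp
  | succ n hn ih =>
    rw [Finset.sum_Ioc_succ_top hn]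
    have hpow : (10 : ℝ) ^ ((i : ℤ) - (n : ℤ))
        = 10 * (10 : ℝ) ^ ((i : ℤ) - ((n + 1 : ℕ) : ℤ)) := by
      rw [← zpow_one_add₀ (by norm_num)]
      congr 1
      push_cast
      ring
    have hterm := mul_le_mul_of_nonneg_left (hd (n + 1))
      (zpow_nonneg (by norm_num : (0 : ℝ) ≤ 10) ((i : ℤ) - ((n + 1 : ℕ) : ℤ)))
    linarith

/-- Shifting a decimal expansion by `10 ^ i` and removing the digits before position `i` leaves
the digit at position `i` plus the shifted tail. -/
lemma zpow_mul_sum_digits_sub (d : ℕ → ℝ) {i N : ℕ} (hi : 1 ≤ i) (hiN : i ≤ N) :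
    (10 : ℝ) ^ (i : ℤ) * ∑ j ∈ Finset.Icc 1 N, d j * (10 : ℝ) ^ (-(j : ℤ))
        - ∑ j ∈ Finset.Icc 1 (i - 1), (10 : ℝ) ^ ((i : ℤ) - (j : ℤ)) * d j
      = d i + ∑ j ∈ Finset.Ioc i N, (10 : ℝ) ^ ((i : ℤ) - (j : ℤ)) * d j := by
  obtain ⟨k, rfl⟩ := Nat.exists_eq_add_of_le' hi
  have hshift : (10 : ℝ) ^ ((k + 1 : ℕ) : ℤ) * ∑ j ∈ Finset.Icc 1 N, d j * (10 : ℝ) ^ (-(j : ℤ))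
      = ∑ j ∈ Finset.Ioc 0 N, (10 : ℝ) ^ (((k + 1 : ℕ) : ℤ) - (j : ℤ)) * d j := by
    rw [Finset.mul_sum]
    refine Finset.sum_congr rfl fun j _ => ?_
    rw [sub_eq_add_neg, zpow_add₀ (by norm_num)]
    ring
  rw [hshift, ← Finset.sum_Ioc_consecutive _ (Nat.zero_le (k + 1)) hiN,
    Finset.sum_Ioc_succ_top (Nat.zero_le k), Nat.add_sub_cancel, sub_self, zpow_zero, one_mul,
    show Finset.Icc 1 k = Finset.Ioc 0 k from rfl]
  ring

/-- For `N ≥ 1`, binary digits `d₁, …, d_N ∈ {0,1}`,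
`x = Σ_{j=1}^N d_j·10^{−j}`, `φ(z) = 10^{N+1}·(ReLU(z) − ReLU(z − 10^{−(N+1)}))`, and the
recursively defined values `r_i = φ(10^i·x − Σ_{j=1}^{i−1} 10^{i−j}·r_j − 1 + 10^{−(N+1)})`,
one has `r_i = d_i` for all `i ∈ {1, …, N}`. -/
theorem mlp_recovers_digits (N : ℕ) (hN : 1 ≤ N) (d : ℕ → ℝ)
    (hd : ∀ j, d j = 0 ∨ d j = 1)
    (x : ℝ) (hx : x = ∑ j ∈ Finset.Icc 1 N, d j * (10 : ℝ) ^ (-(j : ℤ)))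
    (φ : ℝ → ℝ)
    (hφ : ∀ z, φ z = (10 : ℝ) ^ ((N : ℤ) + 1) *
      (max z 0 - max (z - (10 : ℝ) ^ (-((N : ℤ) + 1))) 0))
    (r : ℕ → ℝ)
    (hr : ∀ i ∈ Finset.Icc 1 N,
      r i = φ ((10 : ℝ) ^ (i : ℤ) * x
        - (∑ j ∈ Finset.Icc 1 (i - 1), (10 : ℝ) ^ ((i : ℤ) - (j : ℤ)) * r j)
        - 1 + (10 : ℝ) ^ (-((N : ℤ) + 1)))) :
    ∀ i ∈ Finset.Icc 1 N, r i = d i := by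
  have hd0 : ∀ j, 0 ≤ d j := fun j => by rcases hd j with h | h <;> simp [h]
  have hd1 : ∀ j, d j ≤ 1 := fun j => by rcases hd j with h | h <;> simp [h]
  intro i
  induction i using Nat.strong_induction_on with
  | _ i ih =>
    intro hi
    obtain ⟨hi1, hiN⟩ := Finset.mem_Icc.mp hi
    have hprev : ∑ j ∈ Finset.Icc 1 (i - 1), (10 : ℝ) ^ ((i : ℤ) - (j : ℤ)) * r j
        = ∑ j ∈ Finset.Icc 1 (i - 1), (10 : ℝ) ^ ((i : ℤ) - (j : ℤ)) * d j := by
      refine Finset.sum_congr rfl fun j hj => ?_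
      obtain ⟨hj1, hji⟩ := Finset.mem_Icc.mp hj
      rw [ih j (by omega) (Finset.mem_Icc.mpr ⟨hj1, by omega⟩)]
    rw [hr i hi, hprev, hx, zpow_mul_sum_digits_sub d hi1 hiN, hφ]
    have ht0 : 0 ≤ ∑ j ∈ Finset.Ioc i N, (10 : ℝ) ^ ((i : ℤ) - (j : ℤ)) * d j :=
      Finset.sum_nonneg fun j _ => mul_nonneg (by positivity) (hd0 j)
    have ht1 := sum_Ioc_digits_le hd1 hiN
    have htail : (0 : ℝ) < (10 : ℝ) ^ ((i : ℤ) - (N : ℤ)) := by positivity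
    have hδ0 : (0 : ℝ) < (10 : ℝ) ^ (-((N : ℤ) + 1)) := by positivity
    have hδ1 : (10 : ℝ) ^ (-((N : ℤ) + 1)) ≤ 10 ^ (-1 : ℤ) :=
      zpow_le_zpow_right₀ (by norm_num) (by omega)
    have hmul : (10 : ℝ) ^ ((N : ℤ) + 1) * (10 : ℝ) ^ (-((N : ℤ) + 1)) = 1 := by
      rw [← zpow_add₀ (by norm_num), add_neg_cancel, zpow_zero]
    norm_num at hδ1
    rcases hd i with h | h
    · rw [h, max_eq_right (by norm_num; linarith), max_eq_right (by norm_num; linarith)]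
      simp
    · rw [h, max_eq_left (by linarith), max_eq_left (by linarith), sub_sub_cancel, hmul]
end

section
/- Let D ≥ 1 and x ∈ ℝ^D, and let M = max_d x_d. Suppose that x_d ≤ M − 1 for every d ∉ argmax(x). Then sparsemax(x) = hardmax(x); i.e., the Euclidean projection of x onto the probability simplex Δ^{D−1} is the vector assigning 1/|argmax(x)| to each coordinate in argmax(x) and 0 to all other coordinates. -/
/-- The probability simplex `Δ^{D−1} ⊆ ℝ^D`. -/
def simplex (D : ℕ) : Set (Fin D → ℝ) :=
  {p | (∀ d, 0 ≤ p d) ∧ ∑ d, p d = 1}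

theorem hardmax_eq_ite {D : ℕ} (x : Fin D → ℝ) (M : ℝ) (hM : IsGreatest (Set.range x) M)
    (d : Fin D) :
    hardmax x d =
      if x d = M then 1 / ((Finset.univ.filter fun i => x i = M).card : ℝ) else 0 := by
  classical
  have argmax_iff (d : Fin D) : (∀ i, x i ≤ x d) ↔ x d = M := by
    obtain ⟨⟨m, rfl⟩, hub⟩ := hM
    exact ⟨fun h => le_antisymm (hub ⟨d, rfl⟩) (h m), fun h i => h ▸ hub ⟨i, rfl⟩⟩
  simp only [hardmax, argmax_iff]

theorem one_le_card_argmax {D : ℕ} (x : Fin D → ℝ) (M : ℝ) (hM : IsGreatest (Set.range x) M) :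
    (1 : ℝ) ≤ ((Finset.univ.filter fun i => x i = M).card : ℝ) := by
  obtain ⟨⟨m, hm⟩, -⟩ := hM
  exact_mod_cast Finset.card_pos.mpr ⟨m, by simp [hm]⟩

theorem hardmax_mem_simplex {D : ℕ} (x : Fin D → ℝ) (M : ℝ) (hM : IsGreatest (Set.range x) M) :
    hardmax x ∈ simplex D := by
  have hk := one_le_card_argmax x M hM
  refine ⟨fun d => ?_, ?_⟩
  · rw [hardmax_eq_ite x M hM]
    split_ifs <;> positivity
  · simp only [hardmax_eq_ite x M hM]
    rw [← Finset.sum_filter, Finset.sum_const, nsmul_eq_mul]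
    field_simp

theorem sum_sq_hardmax_sub_add_le {D : ℕ} (x : Fin D → ℝ) (M : ℝ)
    (hM : IsGreatest (Set.range x) M) (hgap : ∀ d, x d ≠ M → x d ≤ M - 1)
    {p : Fin D → ℝ} (hp : p ∈ simplex D) :
    ∑ d, (hardmax x d - x d) ^ 2 + ∑ d, (p d - hardmax x d) ^ 2 ≤ ∑ d, (p d - x d) ^ 2 := by
  have hh := hardmax_mem_simplex x M hM
  have hk := one_le_card_argmax x M hM
  have hk' : 1 / ((Finset.univ.filter fun i => x i = M).card : ℝ) ≤ 1 :=
    div_le_one_of_le₀ hk (by positivity)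
  set c : ℝ := 1 / ((Finset.univ.filter fun i => x i = M).card : ℝ) with hc
  have hzero : ∑ d, 2 * (c - M) * (p d - hardmax x d) = 0 := by
    rw [← Finset.mul_sum, Finset.sum_sub_distrib, hp.2, hh.2, sub_self, mul_zero]
  rw [← add_zero (_ + _), ← hzero, ← Finset.sum_add_distrib, ← Finset.sum_add_distrib]
  refine Finset.sum_le_sum fun d _ => ?_
  rw [hardmax_eq_ite x M hM, ← hc]
  split_ifs with hd
  · rw [hd]
    exact le_of_eq (by ring)
  · nlinarith [mul_nonneg (hp.1 d) (show 0 ≤ M - c - x d by linarith [hgap d hd])]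

/-- Let `D ≥ 1`, `x ∈ ℝ^D`, `M = max_d x_d`, and assume `x_d ≤ M − 1` for all
`d` outside the argmax set. Then `sparsemax(x) = hardmax(x)`: `hardmax x` lies in the
probability simplex, it minimizes `‖p − x‖₂²` over the simplex, and it is the unique such
minimizer. -/
theorem sparsemax_eq_hardmax (D : ℕ) (hD : 1 ≤ D) (x : Fin D → ℝ)
    (M : ℝ) (hM : IsGreatest (Set.range x) M)
    (hgap : ∀ d, x d ≠ M → x d ≤ M - 1) :
    hardmax x ∈ simplex D ∧
    (∀ p ∈ simplex D, ∑ d, (hardmax x d - x d) ^ 2 ≤ ∑ d, (p d - x d) ^ 2) ∧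
    (∀ p ∈ simplex D,
      (∑ d, (p d - x d) ^ 2 = ∑ d, (hardmax x d - x d) ^ 2) → p = hardmax x) := by
  have key {p : Fin D → ℝ} (hp : p ∈ simplex D) := sum_sq_hardmax_sub_add_le x M hM hgap hp
  have hnonneg (p : Fin D → ℝ) : 0 ≤ ∑ d, (p d - hardmax x d) ^ 2 :=
    Finset.sum_nonneg fun d _ => sq_nonneg _
  refine ⟨hardmax_mem_simplex x M hM, fun p hp => by linarith [key hp, hnonneg p],
    fun p hp heq => ?_⟩
  have hsum : ∑ d, (p d - hardmax x d) ^ 2 = 0 := by linarith [key hp, hnonneg p]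
  rw [Finset.sum_eq_zero_iff_of_nonneg fun d _ => sq_nonneg _] at hsum
  funext d
  exact sub_eq_zero.mp (pow_eq_zero_iff two_ne_zero |>.mp (hsum d (Finset.mem_univ d)))
end
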